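/- Let S ⊆ G_d be such that p(S) is a vertex of the White Whale H_∞^+(d,1), and let g ∈ G_d \ S. If the cardinality of S⟨g⟩ is not equal to 2^{σ(g)−1} − 1, then p(S ∪ {g}) is not a vertex of H_∞^+(d,1). -/

import Mathlib

/-- The set `G_d` of generators of the White Whale:
all nonzero 0/1-valued vectors of `ℝ^d`. -/
def whaleGens (d : ℕ) : Set (Fin d → ℝ) :=
  {g | g ≠ 0 ∧ ∀ i, g i = 0 ∨ g i = 1}

/-- The point `p(S)`: the sum of the vectors in `S` (with `p(∅) = 0`). -/
noncomputable def whaleSum {d : ℕ} (S : Set (Fin d → ℝ)) : Fin d → ℝ :=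
  ∑ᶠ g ∈ S, g

/-- The White Whale `H_∞^+(d,1)`: the convex hull of the points `p(S)`
over all subsets `S ⊆ G_d`. -/
noncomputable def whiteWhale (d : ℕ) : Set (Fin d → ℝ) :=
  convexHull ℝ {x | ∃ S : Set (Fin d → ℝ), S ⊆ whaleGens d ∧ x = whaleSum S}

/-- A vertex of the White Whale is an extreme point of it. -/
def IsWhaleVertex (d : ℕ) (x : Fin d → ℝ) : Prop :=
  x ∈ Set.extremePoints ℝ (whiteWhale d)

theorem whaleGens_finite (d : ℕ) : (whaleGens d).Finite := by
  refine (Set.finite_range fun T : Set (Fin d) => T.indicator (1 : Fin d → ℝ)).subset ?_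
  rintro g ⟨-, hg⟩
  refine ⟨{i | g i = 1}, ?_⟩
  ext i
  rcases hg i with hi | hi <;> simp [Set.indicator, hi]

theorem whaleSum_insert {d : ℕ} {S : Set (Fin d → ℝ)} (hS : S ⊆ whaleGens d)
    {g : Fin d → ℝ} (hg : g ∉ S) : whaleSum (insert g S) = g + whaleSum S :=
  finsum_mem_insert (fun g => g) hg ((whaleGens_finite d).subset hS)

theorem whaleSum_sdiff_singleton {d : ℕ} {S : Set (Fin d → ℝ)} (hS : S ⊆ whaleGens d)
    {g : Fin d → ℝ} (hg : g ∈ S) : whaleSum (S \ {g}) = whaleSum S - g := by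
  have h := whaleSum_insert (Set.sdiff_subset.trans hS : S \ {g} ⊆ whaleGens d)
    (g := g) (by simp)
  rw [Set.insert_sdiff_singleton, Set.insert_eq_of_mem hg] at h
  rw [h, add_sub_cancel_left]

theorem whaleSum_mem_whiteWhale {d : ℕ} {S : Set (Fin d → ℝ)} (hS : S ⊆ whaleGens d) :
    whaleSum S ∈ whiteWhale d :=
  subset_convexHull ℝ _ ⟨S, hS, rfl⟩

/-- A vertex is not the midpoint of a nondegenerate segment of the White Whale. -/
theorem IsWhaleVertex.eq_zero_of_add_mem_of_sub_mem {d : ℕ} {x v : Fin d → ℝ}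
    (hx : IsWhaleVertex d x) (hadd : x + v ∈ whiteWhale d) (hsub : x - v ∈ whiteWhale d) :
    v = 0 := by
  have hmem : x ∈ openSegment ℝ (x + v) (x - v) :=
    ⟨1 / 2, 1 / 2, by norm_num, by norm_num, by norm_num, by module⟩
  simpa using hx.2 hadd hsub hmem

/-- If `p(S)` is a vertex and `h + k` is a generator outside `S`, then the generators
`h` and `k` are not both in `S`. -/
theorem IsWhaleVertex.notMem_of_add_notMem {d : ℕ} {S : Set (Fin d → ℝ)}
    (hS : S ⊆ whaleGens d) (hv : IsWhaleVertex d (whaleSum S)) {h k : Fin d → ℝ}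
    (hg : h + k ∈ whaleGens d) (hgS : h + k ∉ S) (hh : h ∈ S) : k ∉ S := by
  intro hk
  refine (hS hk).1 (hv.eq_zero_of_add_mem_of_sub_mem ?_ ?_)
  · have hsub : S \ {h} ⊆ whaleGens d := Set.sdiff_subset.trans hS
    convert whaleSum_mem_whiteWhale (Set.insert_subset hg hsub) using 1
    rw [whaleSum_insert hsub fun hmem => hgS hmem.1, whaleSum_sdiff_singleton hS hh]
    abel
  · rw [← whaleSum_sdiff_singleton hS hk]
    exact whaleSum_mem_whiteWhale (Set.sdiff_subset.trans hS)

/-- If `p(S ∪ {h + k})` is a vertex for a generator `h + k` outside `S`, then one of the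
generators `h` and `k` is in `S`. -/
theorem IsWhaleVertex.mem_of_insert_add {d : ℕ} {S : Set (Fin d → ℝ)}
    (hS : S ⊆ whaleGens d) {h k : Fin d → ℝ}
    (hv : IsWhaleVertex d (whaleSum (insert (h + k) S)))
    (hg : h + k ∈ whaleGens d) (hgS : h + k ∉ S) (hh : h ∈ whaleGens d)
    (hk : k ∈ whaleGens d) (hhS : h ∉ S) : k ∈ S := by
  by_contra hkS
  refine hh.1 (hv.eq_zero_of_add_mem_of_sub_mem ?_ ?_)
  · have hins : insert (h + k) S ⊆ whaleGens d := Set.insert_subset hg hS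
    have hne : h ∉ insert (h + k) S := by
      rintro (heq | hmem)
      · exact hk.1 (by simpa using heq)
      · exact hhS hmem
    rw [add_comm, ← whaleSum_insert hins hne]
    exact whaleSum_mem_whiteWhale (Set.insert_subset hh hins)
  · convert whaleSum_mem_whiteWhale (Set.insert_subset hk hS) using 1
    rw [whaleSum_insert hS hgS, whaleSum_insert hS hkS]
    abel

theorem ncard_zero_one_valued_of_support_subset {d : ℕ} (T : Set (Fin d)) :
    {h : Fin d → ℝ | (∀ i, h i = 0 ∨ h i = 1) ∧ ∀ i, i ∉ T → h i = 0}.ncard =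
      2 ^ T.ncard := by
  rw [← Set.ncard_powerset T]
  symm
  refine Set.ncard_congr (fun U _ => U.indicator 1) ?_ ?_ ?_
  · intro U hU
    refine ⟨fun i => ?_, fun i hi => Set.indicator_of_notMem (fun hiU => hi (hU hiU)) _⟩
    by_cases hi : i ∈ U <;> simp [hi]
  · intro U V _ _ hUV
    exact Set.indicator_one_inj ℝ hUV
  · rintro h ⟨h01, hT⟩
    refine ⟨{i | h i = 1}, fun i hi => ?_, ?_⟩
    · by_contra hiT
      simp [hT i hiT] at hi
    · ext i
      rcases h01 i with hi | hi <;> simp [Set.indicator, hi]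

/-- If p(S) is a vertex of the White Whale, g ∈ G_d \ S and |S⟨g⟩| is not
equal to 2^(σ(g)−1) − 1, then p(S ∪ {g}) is not a vertex. -/
theorem whale_oracle (d : ℕ) (hd : 1 ≤ d)
    (S : Set (Fin d → ℝ)) (hS : S ⊆ whaleGens d)
    (hv : IsWhaleVertex d (whaleSum S))
    (g : Fin d → ℝ) (hg : g ∈ whaleGens d) (hgS : g ∉ S)
    (h : {h ∈ S | ∀ i, g i = 0 → h i = 0}.ncard ≠
          2 ^ ({i : Fin d | g i ≠ 0}.ncard - 1) - 1) :
    ¬ IsWhaleVertex d (whaleSum (S ∪ {g})) := by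
  rw [Set.union_singleton]
  intro hv'
  apply h
  set A : Set (Fin d → ℝ) := {h ∈ S | ∀ i, g i = 0 → h i = 0}
  set C : Set (Fin d → ℝ) := {h | (∀ i, h i = 0 ∨ h i = 1) ∧ ∀ i, g i = 0 → h i = 0}
  have hC : C.ncard = 2 ^ {i : Fin d | g i ≠ 0}.ncard := by
    rw [← ncard_zero_one_valued_of_support_subset]
    simp [C]
  have hAfin : A.Finite := (whaleGens_finite d).subset fun k hk => hS hk.1
  have hcompl : ∀ k ∈ C, g - k ∈ C := by
    rintro k ⟨h01, hsupp⟩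
    refine ⟨fun i => ?_, fun i hi => by simp [hi, hsupp i hi]⟩
    rcases hg.2 i with hi | hi
    · simp [hi, hsupp i hi]
    · rcases h01 i with hk | hk <;> simp [hi, hk]
  have hAC : A ⊆ C := fun k hk => ⟨(hS hk.1).2, hk.2⟩
  have hgC : g ∈ C := ⟨hg.2, fun _ hi => hi⟩
  have h0S : (0 : Fin d → ℝ) ∉ S := fun h0 => (hS h0).1 rfl
  have hsplit : C = insert 0 (insert g (A ∪ (fun k => g - k) '' A)) := by
    apply Set.Subset.antisymm
    · intro k hk
      by_cases hk0 : k = 0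
      · exact Or.inl hk0
      by_cases hkg : k = g
      · exact Or.inr (Or.inl hkg)
      by_cases hkS : k ∈ S
      · exact Or.inr (Or.inr (Or.inl ⟨hkS, hk.2⟩))
      refine Or.inr (Or.inr (Or.inr ⟨g - k, ⟨?_, (hcompl k hk).2⟩, by simp⟩))
      have hadd : k + (g - k) = g := by abel
      refine IsWhaleVertex.mem_of_insert_add hS (h := k) ?_ ?_ ?_ ⟨hk0, hk.1⟩
        ⟨sub_ne_zero.mpr (Ne.symm hkg), (hcompl k hk).1⟩ hkS <;> rwa [hadd]
    · refine Set.insert_subset (by simp [C]) (Set.insert_subset hgC (Set.union_subset hAC ?_))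
      rintro _ ⟨k, hk, rfl⟩
      exact hcompl k (hAC hk)
  have hdisj : Disjoint A ((fun k => g - k) '' A) := by
    rw [Set.disjoint_left]
    rintro _ hk ⟨k, hk', rfl⟩
    have hadd : k + (g - k) = g := by abel
    exact hv.notMem_of_add_notMem hS (by rwa [hadd]) (by rwa [hadd]) hk'.1 hk.1
  have himage : ((fun k => g - k) '' A).ncard = A.ncard :=
    Set.ncard_image_of_injective A sub_right_injective
  have hg' : g ∉ A ∪ (fun k => g - k) '' A := by
    rintro (hgA | ⟨k, hk, hkg⟩)
    · exact hgS hgA.1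
    · have hk0 : k = 0 := by simpa using hkg
      exact h0S (hk0 ▸ hk.1)
  have h0 : (0 : Fin d → ℝ) ∉ insert g (A ∪ (fun k => g - k) '' A) := by
    rintro (h0g | h0A | ⟨k, hk, hkg⟩)
    · exact hg.1 h0g.symm
    · exact h0S h0A.1
    · have hk' : g = k := sub_eq_zero.mp hkg
      exact hgS (hk' ▸ hk.1)
  have hfin : (A ∪ (fun k => g - k) '' A).Finite := hAfin.union (hAfin.image _)
  rw [hsplit, Set.ncard_insert_of_notMem h0 (hfin.insert g), Set.ncard_insert_of_notMem hg' hfin,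
    Set.ncard_union_eq hdisj hAfin (hAfin.image _), himage] at hC
  have hpos : {i : Fin d | g i ≠ 0}.ncard ≠ 0 := by
    rw [Ne, Set.ncard_eq_zero, ← Ne, ← Set.nonempty_iff_ne_empty]
    exact Function.ne_iff.mp hg.1
  obtain ⟨n, hn⟩ := Nat.exists_eq_succ_of_ne_zero hpos
  rw [hn, pow_succ] at hC
  rw [hn, Nat.succ_sub_one]
  omega
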